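/- arXiv:1909.11563 — 3 statements merged into one kernel-verified Lean document; each statement's English description precedes it below -/
import Mathlib

section
/- Let A₀ : D(A₀) ⊆ H₀ → H₁ and A₁ : D(A₁) ⊆ H₁ → H₂ be densely defined closed linear operators satisfying the complex property R(A₀) ⊆ N(A₁), and assume the embedding D(A₁) ∩ D(A₀*) ↪ H₁ is compact. Then the operator A₀A₀* + A₁*A₁ is self-adjoint on H₁: it is densely defined and equals its own Hilbert adjoint. -/
open Filter Topology

/-- Composition of partially defined linear maps: `pComp S T` is `S ∘ T` with natural domain
`{x ∈ D(T) : T x ∈ D(S)}`. -/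
noncomputable def pComp {R E F G : Type*} [Ring R] [AddCommGroup E] [Module R E]
    [AddCommGroup F] [Module R F] [AddCommGroup G] [Module R G]
    (S : F →ₗ.[R] G) (T : E →ₗ.[R] F) : E →ₗ.[R] G where
  domain := (S.domain.comap T.toFun).map T.domain.subtype
  toFun := (S.toFun.comp (T.toFun.restrict fun _ hx => Submodule.mem_comap.mp hx)).comp
    (Submodule.equivMapOfInjective T.domain.subtype (Submodule.injective_subtype _)
      (S.domain.comap T.toFun)).symm.toLinearMap

/-- Compactness of the embedding `D(T) ∩ D(S) ↪ H₁` for two partially defined operators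
`T : H₁ →ₗ.[𝕜] H₂` and `S : H₁ →ₗ.[𝕜] H₀` (with the joint graph norm). -/
def CompactPair {𝕜 H₀ H₁ H₂ : Type*} [RCLike 𝕜]
    [NormedAddCommGroup H₀] [InnerProductSpace 𝕜 H₀]
    [NormedAddCommGroup H₁] [InnerProductSpace 𝕜 H₁]
    [NormedAddCommGroup H₂] [InnerProductSpace 𝕜 H₂]
    (T : H₁ →ₗ.[𝕜] H₂) (S : H₁ →ₗ.[𝕜] H₀) : Prop :=
  ∀ (x : ℕ → H₁) (h1 : ∀ n, x n ∈ T.domain) (h0 : ∀ n, x n ∈ S.domain),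
    (∃ C : ℝ, ∀ n, ‖x n‖ + ‖T ⟨x n, h1 n⟩‖ + ‖S ⟨x n, h0 n⟩‖ ≤ C) →
    ∃ φ : ℕ → ℕ, StrictMono φ ∧ ∃ l : H₁, Tendsto (fun k => x (φ k)) atTop (𝓝 l)

variable {𝕜 H₀ H₁ H₂ : Type*} [RCLike 𝕜]
  [NormedAddCommGroup H₀] [InnerProductSpace 𝕜 H₀] [CompleteSpace H₀]
  [NormedAddCommGroup H₁] [InnerProductSpace 𝕜 H₁] [CompleteSpace H₁]
  [NormedAddCommGroup H₂] [InnerProductSpace 𝕜 H₂] [CompleteSpace H₂]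

section PComp

variable {R E F G : Type*} [Ring R] [AddCommGroup E] [Module R E]
  [AddCommGroup F] [Module R F] [AddCommGroup G] [Module R G]
  {S : F →ₗ.[R] G} {T : E →ₗ.[R] F}

theorem mem_pComp_domain_iff {x : E} :
    x ∈ (pComp S T).domain ↔ ∃ h : x ∈ T.domain, T ⟨x, h⟩ ∈ S.domain := by
  constructor
  · rintro ⟨y, hy, rfl⟩
    exact ⟨y.2, hy⟩
  · rintro ⟨h, h'⟩
    exact ⟨⟨x, h⟩, h', rfl⟩

theorem pComp_apply {x : E} (hx : x ∈ (pComp S T).domain) (h : x ∈ T.domain)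
    (h' : T ⟨x, h⟩ ∈ S.domain) : pComp S T ⟨x, hx⟩ = S ⟨T ⟨x, h⟩, h'⟩ := by
  have key : (Submodule.equivMapOfInjective T.domain.subtype (Submodule.injective_subtype _)
      (S.domain.comap T.toFun)).symm ⟨x, hx⟩ = ⟨⟨x, h⟩, h'⟩ := by
    rw [LinearEquiv.symm_apply_eq]
    rfl
  change (S.toFun.comp (T.toFun.restrict fun _ hx => Submodule.mem_comap.mp hx))
    ((Submodule.equivMapOfInjective T.domain.subtype (Submodule.injective_subtype _)
      (S.domain.comap T.toFun)).symm ⟨x, hx⟩) = _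
  rw [key]
  rfl

end PComp

namespace LinearPMap

/-- The graph of a closed densely defined operator and the rotated graph of its adjoint
together span the product space. -/
theorem IsClosed.exists_sub_adjoint_add {T : H₀ →ₗ.[𝕜] H₁} (hc : T.IsClosed)
    (hd : Dense (T.domain : Set H₀)) (p : H₀) (q : H₁) :
    ∃ (y : T.domain) (v : T.adjoint.domain), p = y - T.adjoint v ∧ q = T y + v := by
  let K : Submodule 𝕜 (WithLp 2 (H₀ × H₁)) :=
    T.graph.comap (WithLp.linearEquiv 2 𝕜 (H₀ × H₁)).toLinearMap
  have hK : _root_.IsClosed (K : Set (WithLp 2 (H₀ × H₁))) :=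
    hc.preimage (WithLp.prod_continuous_ofLp 2 H₀ H₁)
  have : CompleteSpace K := hK.completeSpace_coe
  obtain ⟨a, ha, b, hb, hab⟩ := K.exists_add_mem_mem_orthogonal (WithLp.toLp 2 (p, q))
  obtain ⟨y, hy₁, hy₂⟩ := (T.mem_graph_iff).1 (show a.ofLp ∈ T.graph from ha)
  have horth : ∀ x : T.domain, inner 𝕜 (-b.ofLp.1) (x : H₀) = inner 𝕜 b.ofLp.2 (T x) := by
    intro x
    have h := (K.mem_orthogonal' b).1 hb (WithLp.toLp 2 ((x : H₀), T x)) (T.mem_graph x)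
    rw [WithLp.prod_inner_apply] at h
    rw [inner_neg_left]
    exact neg_eq_of_add_eq_zero_right h
  have hv : b.ofLp.2 ∈ T.adjoint.domain := mem_adjoint_domain_of_exists _ ⟨_, horth⟩
  refine ⟨y, ⟨b.ofLp.2, hv⟩, ?_, ?_⟩
  · rw [adjoint_apply_eq hd ⟨b.ofLp.2, hv⟩ horth, hy₁, sub_neg_eq_add]
    exact congrArg (fun z => z.ofLp.1) hab
  · rw [hy₂]
    exact congrArg (fun z => z.ofLp.2) hab

/-- A symmetric operator `L` such that `1 + L` is surjective is densely defined and
self-adjoint. -/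
theorem IsFormalAdjoint.dense_and_adjoint_eq {L : H₁ →ₗ.[𝕜] H₁} (hL : L.IsFormalAdjoint L)
    (hsurj : ∀ f : H₁, ∃ x : L.domain, (x : H₁) + L x = f) :
    Dense (L.domain : Set H₁) ∧ L.adjoint = L := by
  have hd : Dense (L.domain : Set H₁) := by
    rw [Submodule.dense_iff_topologicalClosure_eq_top, Submodule.topologicalClosure_eq_top_iff,
      Submodule.eq_bot_iff]
    intro z hz
    obtain ⟨x, rfl⟩ := hsurj z
    obtain ⟨w, hw⟩ := hsurj x
    have h := (Submodule.mem_orthogonal' _ _).1 hz w w.2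
    rw [inner_add_left, hL, ← inner_add_right, hw, inner_self_eq_zero] at h
    obtain rfl : x = 0 := Subtype.ext h
    simp
  have hle : L ≤ L.adjoint := hL.le_adjoint hd
  refine ⟨hd, (eq_of_le_of_domain_eq hle (le_antisymm hle.1 fun y hy => ?_)).symm⟩
  obtain ⟨x, hx⟩ := hsurj (y + L.adjoint ⟨y, hy⟩)
  obtain ⟨w, hw⟩ := hsurj (y - x)
  have h : inner 𝕜 (y - (x : H₁)) ((w : H₁) + L w) = 0 := by
    have h₁ := adjoint_isFormalAdjoint hd ⟨y, hy⟩ w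
    have h₂ := hL x w
    have h₃ := congrArg (fun z => inner 𝕜 z (w : H₁)) hx
    simp only [inner_add_left, inner_sub_left, inner_add_right] at h₁ h₂ h₃ ⊢
    linear_combination -h₃ - h₁ + h₂
  rw [hw, inner_self_eq_zero, sub_eq_zero] at h
  exact h ▸ x.2

/-- If `T₁ ∘ T₀ = 0` on `D(T₀)`, then `T₀* ∘ T₁* = 0` on `D(T₁*)`. -/
theorem adjoint_apply_adjoint_eq_zero {E F G : Type*}
    [NormedAddCommGroup E] [InnerProductSpace 𝕜 E] [CompleteSpace E]
    [NormedAddCommGroup F] [InnerProductSpace 𝕜 F] [CompleteSpace F]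
    [NormedAddCommGroup G] [InnerProductSpace 𝕜 G]
    {T₀ : E →ₗ.[𝕜] F} {T₁ : F →ₗ.[𝕜] G}
    (hd₀ : Dense (T₀.domain : Set E)) (hd₁ : Dense (T₁.domain : Set F))
    (hcplx : ∀ x : T₀.domain, ∃ h : T₀ x ∈ T₁.domain, T₁ ⟨T₀ x, h⟩ = 0)
    (y : T₁.adjoint.domain) :
    ∃ h : T₁.adjoint y ∈ T₀.adjoint.domain, T₀.adjoint ⟨T₁.adjoint y, h⟩ = 0 := by
  have key : ∀ x : T₀.domain, inner 𝕜 (0 : E) (x : E) = inner 𝕜 (T₁.adjoint y) (T₀ x) := by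
    intro x
    obtain ⟨h, h'⟩ := hcplx x
    rw [adjoint_isFormalAdjoint hd₁ y ⟨T₀ x, h⟩, h', inner_zero_left, inner_zero_right]
  exact ⟨mem_adjoint_domain_of_exists _ ⟨0, key⟩, adjoint_apply_eq hd₀ _ key⟩

end LinearPMap

/-- For a Hilbert complex `A₀, A₁` with compact embedding
`D(A₁) ∩ D(A₀*) ↪ H₁`, the operator `A₀A₀* + A₁*A₁` (with its natural domain) is
self-adjoint on `H₁`: densely defined and equal to its own Hilbert adjoint. -/
theorem hodge_laplacian_selfAdjoint
    (T₀ : H₀ →ₗ.[𝕜] H₁) (T₁ : H₁ →ₗ.[𝕜] H₂)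
    (hd₀ : Dense (T₀.domain : Set H₀)) (hc₀ : T₀.IsClosed)
    (hd₁ : Dense (T₁.domain : Set H₁)) (hc₁ : T₁.IsClosed)
    (hcplx : ∀ x : T₀.domain, ∃ h : T₀ x ∈ T₁.domain, T₁ ⟨T₀ x, h⟩ = 0)
    (hcpt : CompactPair T₁ T₀.adjoint) :
    Dense (((pComp T₀ T₀.adjoint) + (pComp T₁.adjoint T₁)).domain : Set H₁) ∧
    ((pComp T₀ T₀.adjoint) + (pComp T₁.adjoint T₁)).adjoint =
      (pComp T₀ T₀.adjoint) + (pComp T₁.adjoint T₁) := by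
  refine LinearPMap.IsFormalAdjoint.dense_and_adjoint_eq ?_ ?_
  · rintro ⟨x, hx⟩ ⟨y, hy⟩
    obtain ⟨hx₀, hx₀'⟩ := mem_pComp_domain_iff.1 hx.1
    obtain ⟨hx₁, hx₁'⟩ := mem_pComp_domain_iff.1 hx.2
    obtain ⟨hy₀, hy₀'⟩ := mem_pComp_domain_iff.1 hy.1
    obtain ⟨hy₁, hy₁'⟩ := mem_pComp_domain_iff.1 hy.2
    have a₀ := LinearPMap.adjoint_isFormalAdjoint hd₀
    have a₁ := LinearPMap.adjoint_isFormalAdjoint hd₁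
    rw [LinearPMap.add_apply, LinearPMap.add_apply, pComp_apply hx.1 hx₀ hx₀',
      pComp_apply hx.2 hx₁ hx₁', pComp_apply hy.1 hy₀ hy₀', pComp_apply hy.2 hy₁ hy₁',
      inner_add_left, inner_add_right]
    congr 1
    · exact (a₀.symm ⟨_, hx₀'⟩ ⟨y, hy₀⟩).trans (a₀ ⟨x, hx₀⟩ ⟨_, hy₀'⟩)
    · exact (a₁ ⟨_, hx₁'⟩ ⟨y, hy₁⟩).trans (a₁.symm ⟨x, hx₁⟩ ⟨_, hy₁'⟩)
  · intro f
    obtain ⟨u, x₀, hu, hx₀⟩ := hc₀.exists_sub_adjoint_add hd₀ 0 f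
    obtain ⟨x₁, v, hx₁, hv⟩ := hc₁.exists_sub_adjoint_add hd₁ f 0
    obtain ⟨hu₁, hu₁'⟩ := hcplx u
    obtain ⟨hv₀, hv₀'⟩ := LinearPMap.adjoint_apply_adjoint_eq_zero hd₀ hd₁ hcplx v
    have hu' : T₀.adjoint x₀ = u := (sub_eq_zero.1 hu.symm).symm
    have hv' : T₁ x₁ = -v := eq_neg_of_add_eq_zero_left hv.symm
    have e₁ : (x₁ : H₁) - T₀ u = x₀ + x₁ - f := by rw [hx₀]; abel
    have e₀ : (x₀ : H₁) + T₁.adjoint v = x₀ + x₁ - f := by rw [hx₁]; abel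
    have m₁ : (x₀ : H₁) + x₁ - f ∈ T₁.domain := e₁ ▸ sub_mem x₁.2 hu₁
    have m₀ : (x₀ : H₁) + x₁ - f ∈ T₀.adjoint.domain := e₀ ▸ add_mem x₀.2 hv₀
    have t₁ : T₁ ⟨(x₀ : H₁) + x₁ - f, m₁⟩ = ((-v : T₁.adjoint.domain) : H₂) := by
      rw [show (⟨(x₀ : H₁) + x₁ - f, m₁⟩ : T₁.domain) = x₁ - ⟨T₀ u, hu₁⟩ from
        Subtype.ext e₁.symm, LinearPMap.map_sub, hu₁', sub_zero, hv']
      rfl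
    have t₀ : T₀.adjoint ⟨(x₀ : H₁) + x₁ - f, m₀⟩ = u := by
      rw [show (⟨(x₀ : H₁) + x₁ - f, m₀⟩ : T₀.adjoint.domain) = x₀ + ⟨T₁.adjoint v, hv₀⟩ from
        Subtype.ext e₀.symm, LinearPMap.map_add, hv₀', add_zero, hu']
    have n₁ : T₁ ⟨(x₀ : H₁) + x₁ - f, m₁⟩ ∈ T₁.adjoint.domain := t₁ ▸ (-v).2
    have n₀ : T₀.adjoint ⟨(x₀ : H₁) + x₁ - f, m₀⟩ ∈ T₀.domain := t₀ ▸ u.2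
    have d₁ := mem_pComp_domain_iff.2 ⟨m₁, n₁⟩
    have d₀ := mem_pComp_domain_iff.2 ⟨m₀, n₀⟩
    refine ⟨⟨(x₀ : H₁) + x₁ - f, d₀, d₁⟩, ?_⟩
    rw [LinearPMap.add_apply, pComp_apply d₀ m₀ n₀, pComp_apply d₁ m₁ n₁,
      show (⟨_, n₁⟩ : T₁.adjoint.domain) = -v from Subtype.ext t₁,
      show (⟨_, n₀⟩ : T₀.domain) = u from Subtype.ext t₀, LinearPMap.map_neg]
    have s₀ : T₀ u = f - x₀ := eq_sub_of_add_eq hx₀.symm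
    have s₁ : T₁.adjoint v = x₁ - f := by rw [hx₁]; abel
    rw [s₀, s₁]
    change (x₀ : H₁) + x₁ - f + (f - x₀ + -(x₁ - f)) = f
    abel
end

section
/- Let A₀ : D(A₀) ⊆ H₀ → H₁ and A₁ : D(A₁) ⊆ H₁ → H₂ be densely defined closed linear operators satisfying the complex property R(A₀) ⊆ N(A₁), and assume the embedding D(A₁) ∩ D(A₀*) ↪ H₁ is compact. Then N(A₀A₀* + A₁*A₁) = N₀,₁ and R(A₀A₀* + A₁*A₁) = N₀,₁^⊥, the orthogonal complement of N₀,₁ in H₁; in particular the range of A₀A₀* + A₁*A₁ is closed. -/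
open Filter Topology

/-- The cohomology group `N₀,₁ = N(A₁) ∩ N(A₀*)` of a Hilbert complex, as a set. -/
def cohomSet {𝕜 H₀ H₁ H₂ : Type*} [RCLike 𝕜]
    [NormedAddCommGroup H₀] [InnerProductSpace 𝕜 H₀] [CompleteSpace H₀]
    [NormedAddCommGroup H₁] [InnerProductSpace 𝕜 H₁]
    [NormedAddCommGroup H₂] [InnerProductSpace 𝕜 H₂]
    (T₀ : H₀ →ₗ.[𝕜] H₁) (T₁ : H₁ →ₗ.[𝕜] H₂) : Set H₁ :=
  {x : H₁ | (∃ h : x ∈ T₁.domain, T₁ ⟨x, h⟩ = 0) ∧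
    (∃ h : x ∈ T₀.adjoint.domain, T₀.adjoint ⟨x, h⟩ = 0)}

variable {𝕜 H₀ H₁ H₂ : Type*} [RCLike 𝕜]
  [NormedAddCommGroup H₀] [InnerProductSpace 𝕜 H₀] [CompleteSpace H₀]
  [NormedAddCommGroup H₁] [InnerProductSpace 𝕜 H₁] [CompleteSpace H₁]
  [NormedAddCommGroup H₂] [InnerProductSpace 𝕜 H₂] [CompleteSpace H₂]

local notation "⟪" x ", " y "⟫" => @inner 𝕜 _ _ x y

namespace LinearPMap

section

variable {E F G : Type*}
  [NormedAddCommGroup E] [InnerProductSpace 𝕜 E]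
  [NormedAddCommGroup F] [InnerProductSpace 𝕜 F]
  [NormedAddCommGroup G] [InnerProductSpace 𝕜 G]

/-- The kernel of a partially defined operator, as a submodule of the ambient space. -/
def kernel (T : E →ₗ.[𝕜] F) : Submodule 𝕜 E :=
  T.graph.comap (LinearMap.inl 𝕜 E F)

theorem mem_kernel_iff {T : E →ₗ.[𝕜] F} {x : E} :
    x ∈ T.kernel ↔ ∃ h : x ∈ T.domain, T ⟨x, h⟩ = 0 := by
  simp [kernel, mem_graph_iff]

theorem isClosed_kernel {T : E →ₗ.[𝕜] F} (hT : T.IsClosed) :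
    _root_.IsClosed (T.kernel : Set E) :=
  hT.preimage (f := fun x : E => (x, (0 : F))) (by fun_prop)

theorem IsClosed.exists_apply_eq_of_tendsto {T : E →ₗ.[𝕜] F} (hT : T.IsClosed)
    {x : ℕ → T.domain} {l : E} {m : F} (hx : Tendsto (fun n => (x n : E)) atTop (𝓝 l))
    (hTx : Tendsto (fun n => T (x n)) atTop (𝓝 m)) :
    ∃ h : l ∈ T.domain, T ⟨l, h⟩ = m := by
  have : (l, m) ∈ T.graph :=
    IsClosed.mem_of_tendsto (b := atTop) hT (hx.prodMk_nhds hTx) (.of_forall fun n => T.mem_graph _)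
  simpa [mem_graph_iff] using this

/-- Splitting off the kernel part of a vector in the domain of an operator. -/
theorem exists_add_mem_kernel {T : E →ₗ.[𝕜] F} [T.kernel.HasOrthogonalProjection] (v : T.domain) :
    ∃ a ∈ T.kernel, ∃ b : T.domain, (b : E) ∈ T.kernelᗮ ∧ T b = T v ∧ (v : E) = a + b := by
  obtain ⟨a, ha, b, hb, hab⟩ := T.kernel.exists_add_mem_mem_orthogonal (v : E)
  obtain ⟨had, ha0⟩ := mem_kernel_iff.1 ha
  have hvb : ((v - ⟨a, had⟩ : T.domain) : E) = b := by simp [hab]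
  exact ⟨a, ha, v - ⟨a, had⟩, hvb ▸ hb, by rw [map_sub, ha0, sub_zero], by simp⟩

/-- The operator `x ↦ (T x, S x)` on `D(T) ∩ D(S)`, with values in the Hilbert sum. -/
noncomputable def pair (T : E →ₗ.[𝕜] F) (S : E →ₗ.[𝕜] G) : E →ₗ.[𝕜] WithLp 2 (F × G) where
  domain := T.domain ⊓ S.domain
  toFun := (WithLp.linearEquiv 2 𝕜 (F × G)).symm.toLinearMap ∘ₗ
    (T.toFun ∘ₗ Submodule.inclusion inf_le_left).prod
      (S.toFun ∘ₗ Submodule.inclusion inf_le_right)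

theorem pair_apply (T : E →ₗ.[𝕜] F) (S : E →ₗ.[𝕜] G) (x : (pair T S).domain) :
    pair T S x = WithLp.toLp 2 (T ⟨x, x.2.1⟩, S ⟨x, x.2.2⟩) := rfl

theorem mem_kernel_pair_iff {T : E →ₗ.[𝕜] F} {S : E →ₗ.[𝕜] G} {x : E} :
    x ∈ (pair T S).kernel ↔ x ∈ T.kernel ∧ x ∈ S.kernel := by
  simp only [mem_kernel_iff, pair_apply, WithLp.toLp_eq_zero, Prod.mk_eq_zero]
  exact ⟨fun ⟨h, h'⟩ => ⟨⟨h.1, h'.1⟩, ⟨h.2, h'.2⟩⟩, fun ⟨⟨h, h'⟩, ⟨k, k'⟩⟩ => ⟨⟨h, k⟩, h', k'⟩⟩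

theorem IsClosed.pair {T : E →ₗ.[𝕜] F} {S : E →ₗ.[𝕜] G} (hT : T.IsClosed) (hS : S.IsClosed) :
    (pair T S).IsClosed := by
  have : ((LinearPMap.pair T S).graph : Set (E × WithLp 2 (F × G))) =
      {p | (p.1, p.2.fst) ∈ T.graph} ∩ {p | (p.1, p.2.snd) ∈ S.graph} := by
    ext ⟨x, y⟩
    simp only [SetLike.mem_coe, mem_graph_iff, Subtype.exists, exists_and_left, exists_eq_left,
      Set.mem_inter_iff, Set.mem_ofPred_eq, pair_apply]
    constructor
    · rintro ⟨h, rfl⟩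
      exact ⟨⟨h.1, rfl⟩, ⟨h.2, rfl⟩⟩
    · rintro ⟨⟨h, h'⟩, ⟨k, k'⟩⟩
      refine ⟨⟨h, k⟩, ?_⟩
      rw [h', k']
      rfl
  rw [LinearPMap.IsClosed, this]
  exact (hT.preimage (f := fun p : E × WithLp 2 (F × G) => (p.1, p.2.fst)) (by fun_prop)).inter
    (hS.preimage (f := fun p : E × WithLp 2 (F × G) => (p.1, p.2.snd)) (by fun_prop))

/-- A closed operator with compactly embedded domain is bounded below on the orthogonal complement
of its kernel. -/
theorem exists_norm_le_of_compact {S : E →ₗ.[𝕜] F} (hS : S.IsClosed)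
    (hcpt : ∀ x : ℕ → S.domain, (∃ C : ℝ, ∀ n, ‖(x n : E)‖ + ‖S (x n)‖ ≤ C) →
      ∃ φ : ℕ → ℕ, StrictMono φ ∧ ∃ l : E, Tendsto (fun k => (x (φ k) : E)) atTop (𝓝 l)) :
    ∃ C : ℝ, ∀ x : S.domain, (x : E) ∈ S.kernelᗮ → ‖(x : E)‖ ≤ C * ‖S x‖ := by
  by_contra! h
  choose x hx hlt using fun n : ℕ => h (n + 1)
  have hpos (n : ℕ) : 0 < ‖(x n : E)‖ := lt_of_le_of_lt (by positivity) (hlt n)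
  set y : ℕ → S.domain := fun n => ((‖(x n : E)‖⁻¹ : ℝ) : 𝕜) • x n with hy
  have hynorm (n : ℕ) : ‖(y n : E)‖ = 1 := by
    simp [hy, norm_smul, (hpos n).ne']
  have hSy (n : ℕ) : ‖S (y n)‖ ≤ 1 / ((n : ℝ) + 1) := by
    have : (0 : ℝ) < n + 1 := by positivity
    rw [hy, map_smul, norm_smul, RCLike.norm_ofReal, abs_of_pos (inv_pos.2 (hpos n)),
      le_div_iff₀ this, mul_assoc, inv_mul_le_iff₀ (hpos n)]
    linarith [hlt n]
  obtain ⟨φ, hφ, l, hl⟩ := hcpt y ⟨2, fun n => by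
    have : 1 / ((n : ℝ) + 1) ≤ 1 := by
      rw [div_le_one (by positivity)]; linarith [(n.cast_nonneg : (0 : ℝ) ≤ n)]
    linarith [hynorm n, hSy n]⟩
  have hS0 : Tendsto (fun n => S (y n)) atTop (𝓝 0) :=
    squeeze_zero_norm hSy tendsto_one_div_add_atTop_nhds_zero_nat
  have hlker : l ∈ S.kernel :=
    mem_kernel_iff.2 (hS.exists_apply_eq_of_tendsto hl (hS0.comp hφ.tendsto_atTop))
  have hlperp : l ∈ S.kernelᗮ :=
    IsClosed.mem_of_tendsto (b := atTop) S.kernel.isClosed_orthogonal hl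
      (.of_forall fun n => Submodule.smul_mem _ _ (hx _))
  have hl1 : ‖l‖ = 1 :=
    tendsto_nhds_unique hl.norm (by simp only [hynorm]; exact tendsto_const_nhds)
  have : l = 0 := by
    simpa using (Submodule.mem_orthogonal _ _).1 hlperp l hlker
  simp [this] at hl1

/-- Riesz representation for the form `⟪S u, S v⟫` of a closed operator bounded below on the
orthogonal complement of its kernel. -/
theorem exists_inner_apply_eq [CompleteSpace E] [CompleteSpace F]
    {S : E →ₗ.[𝕜] F} (hS : S.IsClosed) {C : ℝ}
    (hC : ∀ x : S.domain, (x : E) ∈ S.kernelᗮ → ‖(x : E)‖ ≤ C * ‖S x‖)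
    {f : E} (hf : f ∈ S.kernelᗮ) :
    ∃ u : S.domain, ∀ v : S.domain, inner 𝕜 (S u) (S v) = inner 𝕜 f (v : E) := by
  have : CompleteSpace S.kernel := (isClosed_kernel hS).completeSpace_coe
  have hdecomp (v : S.domain) : ∃ v' : S.domain, (v' : E) ∈ S.kernelᗮ ∧ S v' = S v ∧
      inner 𝕜 f (v' : E) = inner 𝕜 f (v : E) := by
    obtain ⟨p, hp, q, hq, hSq, hpq⟩ := exists_add_mem_kernel v
    refine ⟨q, hq, hSq, ?_⟩
    rw [hpq, inner_add_right, Submodule.inner_left_of_mem_orthogonal hp hf, zero_add]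
  let D : Submodule 𝕜 S.domain := S.kernelᗮ.comap S.domain.subtype
  let L : D →ₗ[𝕜] F := S.toFun ∘ₗ D.subtype
  have hLC (x : D) : ‖((x : S.domain) : E)‖ ≤ C * ‖L x‖ := hC x x.2
  have hinj : Function.Injective L := by
    rw [injective_iff_map_eq_zero]
    intro x hx
    have := hLC x
    rw [hx, norm_zero, mul_zero, norm_le_zero_iff] at this
    exact Subtype.ext (Subtype.ext this)
  have hclosed : _root_.IsClosed (LinearMap.range L : Set F) := by
    refine IsSeqClosed.isClosed fun w m hw hm => ?_
    choose x hx using hw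
    have hcau : CauchySeq fun n => ((x n : S.domain) : E) := by
      have hw := (cauchySeq_iff_tendsto_dist_atTop_0.1 hm.cauchySeq).const_mul C
      rw [mul_zero] at hw
      refine cauchySeq_iff_tendsto_dist_atTop_0.2 (squeeze_zero (fun _ => dist_nonneg) ?_ hw)
      intro n
      have := hLC (x n.1 - x n.2)
      rw [_root_.map_sub, hx, hx, ← dist_eq_norm] at this
      rw [dist_eq_norm]
      exact this
    obtain ⟨l, hl⟩ := cauchySeq_tendsto_of_complete hcau
    have hm' : Tendsto (fun n => S (x n : S.domain)) atTop (𝓝 m) := hm.congr fun n => (hx n).symm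
    obtain ⟨hld, hlm⟩ := hS.exists_apply_eq_of_tendsto hl hm'
    have hlperp : l ∈ S.kernelᗮ :=
      IsClosed.mem_of_tendsto (b := atTop) S.kernel.isClosed_orthogonal hl
        (.of_forall fun n => (x n).2)
    exact ⟨⟨⟨l, hld⟩, hlperp⟩, hlm⟩
  have : CompleteSpace (LinearMap.range L) := hclosed.completeSpace_coe
  let e := LinearEquiv.ofInjective L hinj
  let ℓ : StrongDual 𝕜 (LinearMap.range L) :=
    LinearMap.mkContinuous
      ((innerₛₗ 𝕜 f) ∘ₗ S.domain.subtype ∘ₗ D.subtype ∘ₗ e.symm.toLinearMap) (‖f‖ * C) fun w => by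
        have h1 := hLC (e.symm w)
        have h2 : L (e.symm w) = w := congrArg Subtype.val (e.apply_symm_apply w)
        rw [h2] at h1
        calc _ ≤ ‖f‖ * ‖((e.symm w : S.domain) : E)‖ := norm_inner_le_norm _ _
          _ ≤ ‖f‖ * (C * ‖w‖) := by gcongr; exact h1
          _ = _ := by ring
  obtain ⟨u, hu⟩ := ((InnerProductSpace.toDual 𝕜 (LinearMap.range L)).symm ℓ).2
  refine ⟨u, fun v => ?_⟩
  obtain ⟨v', hv', hSv, hfv⟩ := hdecomp v
  rw [← hSv, ← hfv]
  have key := InnerProductSpace.toDual_symm_apply (x := e ⟨v', hv'⟩) (y := ℓ)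
  rw [Submodule.coe_inner, ← hu] at key
  refine key.trans ?_
  change inner 𝕜 f (((e.symm (e ⟨v', hv'⟩) : D) : S.domain) : E) = _
  rw [LinearEquiv.symm_apply_apply]

end

section

variable {E F : Type*}
  [NormedAddCommGroup E] [InnerProductSpace 𝕜 E] [CompleteSpace E]
  [NormedAddCommGroup F] [InnerProductSpace 𝕜 F]

theorem mem_kernel_adjoint_iff {T : E →ₗ.[𝕜] F} (hT : Dense (T.domain : Set E)) {y : F} :
    y ∈ T.adjoint.kernel ↔ ∀ x : T.domain, inner 𝕜 y (T x) = 0 := by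
  rw [mem_kernel_iff]
  constructor
  · rintro ⟨h, h0⟩ x
    rw [← adjoint_isFormalAdjoint hT ⟨y, h⟩ x, h0, inner_zero_left]
  · intro h
    have h' (x : T.domain) : inner 𝕜 (0 : E) (x : E) = inner 𝕜 y (T x) := by simp [h x]
    exact ⟨mem_adjoint_domain_of_exists y ⟨0, h'⟩, adjoint_apply_eq hT _ h'⟩

/-- A vector which tests against `T†` like an element of `D(T)` lies in `D(T)`: a closed densely
defined operator contains its biadjoint. -/
theorem exists_apply_eq_of_inner_adjoint [CompleteSpace F] {T : E →ₗ.[𝕜] F}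
    (hT : Dense (T.domain : Set E)) (hc : T.IsClosed) {y : E} {w : F}
    (h : ∀ v : T.adjoint.domain, inner 𝕜 y (T.adjoint v) = inner 𝕜 w (v : F)) :
    ∃ hy : y ∈ T.domain, T ⟨y, hy⟩ = w := by
  let g : Submodule 𝕜 (WithLp 2 (E × F)) :=
    T.graph.comap (WithLp.linearEquiv 2 𝕜 (E × F)).toLinearMap
  have hg : _root_.IsClosed (g : Set (WithLp 2 (E × F))) :=
    hc.preimage (WithLp.prod_continuous_ofLp 2 E F)
  have : CompleteSpace g := hg.completeSpace_coe
  have hmem : WithLp.toLp 2 (y, w) ∈ g := by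
    rw [← g.orthogonal_orthogonal, Submodule.mem_orthogonal']
    intro u hu
    have hab (x : T.domain) : inner 𝕜 (-u.fst) (x : E) = inner 𝕜 u.snd (T x) := by
      have : inner 𝕜 u (WithLp.toLp 2 ((x : E), T x)) = 0 :=
        (Submodule.mem_orthogonal' _ _).1 hu _ (T.mem_graph x)
      rw [WithLp.prod_inner_apply] at this
      rw [inner_neg_left]
      exact neg_eq_of_add_eq_zero_right this
    have hd := mem_adjoint_domain_of_exists u.snd ⟨_, hab⟩
    have h1 := h ⟨u.snd, hd⟩
    rw [adjoint_apply_eq hT ⟨u.snd, hd⟩ hab, inner_neg_right] at h1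
    rw [WithLp.prod_inner_apply]
    change inner 𝕜 y u.fst + inner 𝕜 w u.snd = 0
    rw [← h1, add_neg_cancel]
  have : (y, w) ∈ T.graph := hmem
  simpa [mem_graph_iff] using this

end

end LinearPMap

/-- For a Hilbert complex `A₀, A₁` with compact embedding
`D(A₁) ∩ D(A₀*) ↪ H₁`, the kernel of `A₀A₀* + A₁*A₁` equals `N₀,₁` and its range equals
the orthogonal complement of `N₀,₁` in `H₁`; in particular the range is closed. -/
theorem hodge_laplacian_kernel_and_range
    (T₀ : H₀ →ₗ.[𝕜] H₁) (T₁ : H₁ →ₗ.[𝕜] H₂)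
    (hd₀ : Dense (T₀.domain : Set H₀)) (hc₀ : T₀.IsClosed)
    (hd₁ : Dense (T₁.domain : Set H₁)) (hc₁ : T₁.IsClosed)
    (hcplx : ∀ x : T₀.domain, ∃ h : T₀ x ∈ T₁.domain, T₁ ⟨T₀ x, h⟩ = 0)
    (hcpt : CompactPair T₁ T₀.adjoint) :
    {x : H₁ | ∃ (h1 : x ∈ T₁.domain) (h0 : x ∈ T₀.adjoint.domain)
        (h1' : T₁ ⟨x, h1⟩ ∈ T₁.adjoint.domain)
        (h0' : T₀.adjoint ⟨x, h0⟩ ∈ T₀.domain),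
        T₀ ⟨T₀.adjoint ⟨x, h0⟩, h0'⟩ + T₁.adjoint ⟨T₁ ⟨x, h1⟩, h1'⟩ = 0} =
      cohomSet T₀ T₁ ∧
    {y : H₁ | ∃ (x : H₁) (h1 : x ∈ T₁.domain) (h0 : x ∈ T₀.adjoint.domain)
        (h1' : T₁ ⟨x, h1⟩ ∈ T₁.adjoint.domain)
        (h0' : T₀.adjoint ⟨x, h0⟩ ∈ T₀.domain),
        T₀ ⟨T₀.adjoint ⟨x, h0⟩, h0'⟩ + T₁.adjoint ⟨T₁ ⟨x, h1⟩, h1'⟩ = y} =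
      {y : H₁ | ∀ n ∈ cohomSet T₀ T₁, ⟪n, y⟫ = 0} ∧
    IsClosed {y : H₁ | ∃ (x : H₁) (h1 : x ∈ T₁.domain) (h0 : x ∈ T₀.adjoint.domain)
        (h1' : T₁ ⟨x, h1⟩ ∈ T₁.adjoint.domain)
        (h0' : T₀.adjoint ⟨x, h0⟩ ∈ T₀.domain),
        T₀ ⟨T₀.adjoint ⟨x, h0⟩, h0'⟩ + T₁.adjoint ⟨T₁ ⟨x, h1⟩, h1'⟩ = y} := by
  have hcohom : cohomSet T₀ T₁ = ((T₁.kernel ⊓ T₀.adjoint.kernel : Submodule 𝕜 H₁) : Set H₁) := by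
    ext x
    simp [cohomSet, LinearPMap.mem_kernel_iff]
  set N : Submodule 𝕜 H₁ := T₁.kernel ⊓ T₀.adjoint.kernel
  have hperp : {y : H₁ | ∀ n ∈ cohomSet T₀ T₁, ⟪n, y⟫ = 0} = (Nᗮ : Set H₁) := by
    ext y
    simp [hcohom, Submodule.mem_orthogonal]
  have hc₀' : T₀.adjoint.IsClosed := LinearPMap.adjoint_isClosed hd₀
  have hadj₀ := LinearPMap.adjoint_isFormalAdjoint hd₀
  have hadj₁ := LinearPMap.adjoint_isFormalAdjoint hd₁
  have hle₁ : T₁.kernelᗮ ≤ T₀.adjoint.kernel := fun x hx =>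
    (LinearPMap.mem_kernel_adjoint_iff hd₀).2 fun a =>
    Submodule.inner_left_of_mem_orthogonal (LinearPMap.mem_kernel_iff.2 (hcplx a)) hx
  have : CompleteSpace T₁.kernel := (LinearPMap.isClosed_kernel hc₁).completeSpace_coe
  have : CompleteSpace T₀.adjoint.kernel := (LinearPMap.isClosed_kernel hc₀').completeSpace_coe
  have hle₀ : T₀.adjoint.kernelᗮ ≤ T₁.kernel :=
    (Submodule.orthogonal_le hle₁).trans T₁.kernel.orthogonal_orthogonal.le
  have hrange : {y : H₁ | ∃ (x : H₁) (h1 : x ∈ T₁.domain) (h0 : x ∈ T₀.adjoint.domain)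
        (h1' : T₁ ⟨x, h1⟩ ∈ T₁.adjoint.domain)
        (h0' : T₀.adjoint ⟨x, h0⟩ ∈ T₀.domain),
        T₀ ⟨T₀.adjoint ⟨x, h0⟩, h0'⟩ + T₁.adjoint ⟨T₁ ⟨x, h1⟩, h1'⟩ = y} = (Nᗮ : Set H₁) := by
    ext f
    constructor
    · rintro ⟨x, h1, h0, h1', h0', rfl⟩
      refine (Submodule.mem_orthogonal _ _).2 fun n hn => ?_
      obtain ⟨hn1, hn1'⟩ := LinearPMap.mem_kernel_iff.1 hn.1
      have e0 := (LinearPMap.mem_kernel_adjoint_iff hd₀).1 hn.2 ⟨_, h0'⟩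
      have e1 := hadj₁.symm ⟨n, hn1⟩ ⟨_, h1'⟩
      rw [hn1', inner_zero_left] at e1
      rw [inner_add_right, e0, zero_add]
      exact e1.symm
    · intro hf
      have hSc : (LinearPMap.pair T₁ T₀.adjoint).IsClosed := hc₁.pair hc₀'
      obtain ⟨C, hC⟩ := LinearPMap.exists_norm_le_of_compact hSc fun x ⟨C, hx⟩ =>
        hcpt (fun n => x n) (fun n => (x n).2.1) (fun n => (x n).2.2) ⟨2 * C, fun n => by
          have a : ‖T₁ ⟨x n, (x n).2.1⟩‖ ≤ ‖LinearPMap.pair T₁ T₀.adjoint (x n)‖ :=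
            WithLp.norm_fst_le _ (LinearPMap.pair T₁ T₀.adjoint (x n))
          have b : ‖T₀.adjoint ⟨x n, (x n).2.2⟩‖ ≤ ‖LinearPMap.pair T₁ T₀.adjoint (x n)‖ :=
            WithLp.norm_snd_le _ (LinearPMap.pair T₁ T₀.adjoint (x n))
          have c := hx n
          have d := norm_nonneg (x n : H₁)
          linarith⟩
      have hker : (LinearPMap.pair T₁ T₀.adjoint).kernel = N := by
        ext x
        exact LinearPMap.mem_kernel_pair_iff
      obtain ⟨⟨u, hu1, hu0⟩, hu⟩ := LinearPMap.exists_inner_apply_eq hSc hC (hker ▸ hf : f ∈ _)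
      have hu' (v : H₁) (h1 : v ∈ T₁.domain) (h0 : v ∈ T₀.adjoint.domain) :
          ⟪T₁ ⟨u, hu1⟩, T₁ ⟨v, h1⟩⟫ + ⟪T₀.adjoint ⟨u, hu0⟩, T₀.adjoint ⟨v, h0⟩⟫ = ⟪f, v⟫ :=
        hu ⟨v, h1, h0⟩
      obtain ⟨p, hp, q, hq, hpq⟩ := T₁.kernel.exists_add_mem_mem_orthogonal f
      obtain ⟨r, hr, s, hs, hrs⟩ := T₀.adjoint.kernel.exists_add_mem_mem_orthogonal f
      have t1 (v : T₁.domain) : ⟪q, (v : H₁)⟫ = ⟪T₁ ⟨u, hu1⟩, T₁ v⟫ := by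
        obtain ⟨a, ha, b, hb, hTb, hab⟩ := LinearPMap.exists_add_mem_kernel v
        obtain ⟨hbd, hb0⟩ := LinearPMap.mem_kernel_iff.1 (hle₁ hb)
        have := hu' b b.2 hbd
        rw [hb0, inner_zero_right, add_zero, hTb] at this
        rw [this, hab, hpq, inner_add_right, inner_add_left,
          Submodule.inner_left_of_mem_orthogonal ha hq,
          Submodule.inner_right_of_mem_orthogonal hp hb]
      have t0 (v : T₀.adjoint.domain) :
          ⟪T₀.adjoint ⟨u, hu0⟩, T₀.adjoint v⟫ = ⟪s, (v : H₁)⟫ := by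
        obtain ⟨a, ha, b, hb, hTb, hab⟩ := LinearPMap.exists_add_mem_kernel v
        obtain ⟨hbd, hb0⟩ := LinearPMap.mem_kernel_iff.1 (hle₀ hb)
        have := hu' b hbd b.2
        rw [hb0, inner_zero_right, zero_add, hTb] at this
        rw [this, hab, hrs, inner_add_right, inner_add_left,
          Submodule.inner_left_of_mem_orthogonal ha hs,
          Submodule.inner_right_of_mem_orthogonal hr hb]
      have h1' := LinearPMap.mem_adjoint_domain_of_exists _ ⟨q, t1⟩
      obtain ⟨h0', hs'⟩ := LinearPMap.exists_apply_eq_of_inner_adjoint hd₀ hc₀ t0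
      refine ⟨u, hu1, hu0, h1', h0', ?_⟩
      rw [hs', LinearPMap.adjoint_apply_eq hd₁ ⟨_, h1'⟩ t1]
      have hgN : f - (s + q) ∈ N := by
        constructor
        · rw [show f - (s + q) = p - s by rw [hpq]; abel]
          exact sub_mem hp (hle₀ hs)
        · rw [show f - (s + q) = r - q by rw [hrs]; abel]
          exact sub_mem hr (hle₁ hq)
      have hgP : f - (s + q) ∈ Nᗮ :=
        sub_mem hf (add_mem (Submodule.orthogonal_le inf_le_right hs)
          (Submodule.orthogonal_le inf_le_left hq))
      have : f - (s + q) = 0 := by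
        simpa using (Submodule.mem_orthogonal _ _).1 hgP _ hgN
      exact (sub_eq_zero.1 this).symm
  refine ⟨?_, hrange.trans hperp.symm, hrange ▸ N.isClosed_orthogonal⟩
  ext x
  constructor
  · rintro ⟨h1, h0, h1', h0', hx⟩
    have e0 := hadj₀ ⟨x, h0⟩ ⟨_, h0'⟩
    have e1 := hadj₁.symm ⟨x, h1⟩ ⟨_, h1'⟩
    have e : ⟪x, T₀ ⟨T₀.adjoint ⟨x, h0⟩, h0'⟩ + T₁.adjoint ⟨T₁ ⟨x, h1⟩, h1'⟩⟫ = 0 := by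
      rw [hx, inner_zero_right]
    rw [inner_add_right, ← e0, ← e1, inner_self_eq_norm_sq_to_K, inner_self_eq_norm_sq_to_K] at e
    norm_cast at e
    exact ⟨⟨h1, norm_eq_zero.1 (by nlinarith)⟩, ⟨h0, norm_eq_zero.1 (by nlinarith)⟩⟩
  · rintro ⟨⟨h1, h1z⟩, ⟨h0, h0z⟩⟩
    have z0 : T₀ (⟨T₀.adjoint ⟨x, h0⟩, h0z ▸ zero_mem _⟩ : T₀.domain) = 0 := by
      rw [show (⟨T₀.adjoint ⟨x, h0⟩, h0z ▸ zero_mem _⟩ : T₀.domain) = 0 from Subtype.ext h0z,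
        LinearPMap.map_zero]
    have z1 : T₁.adjoint (⟨T₁ ⟨x, h1⟩, h1z ▸ zero_mem _⟩ : T₁.adjoint.domain) = 0 := by
      rw [show (⟨T₁ ⟨x, h1⟩, h1z ▸ zero_mem _⟩ : T₁.adjoint.domain) = 0 from Subtype.ext h1z,
        LinearPMap.map_zero]
    exact ⟨h1, h0, h1z ▸ zero_mem _, h0z ▸ zero_mem _, by rw [z0, z1, add_zero]⟩
end

section
/- Let A₀ : D(A₀) ⊆ H₀ → H₁ and A₁ : D(A₁) ⊆ H₁ → H₂ be densely defined closed linear operators satisfying the complex property R(A₀) ⊆ N(A₁), and assume the embedding D(A₁) ∩ D(A₀*) ↪ H₁ is compact. Then for every scalar λ ≠ 0: λ is an eigenvalue of A₀A₀* + A₁*A₁ if and only if λ is an eigenvalue of A₀A₀* or λ is an eigenvalue of A₁*A₁ (where μ is an eigenvalue of A₀A₀* if A₀A₀*y = μy for some 0 ≠ y ∈ D(A₀*) with A₀*y ∈ D(A₀), and analogously for A₁*A₁). In particular, the smallest positive eigenvalue of A₀A₀* + A₁*A₁ equals min{ λ_{A₀}², λ_{A₁}² }. -/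
open Filter Topology
open scoped ENNReal

/-- The range of a partially defined linear map, as a set. -/
def pRange {R E F : Type*} [Ring R] [AddCommGroup E] [Module R E]
    [AddCommGroup F] [Module R F] (T : E →ₗ.[R] F) : Set F :=
  Set.range fun x : T.domain => T x

/-- The Poincaré–Friedrichs infimum `inf { ‖T x‖ / ‖x‖ : 0 ≠ x ∈ D(T) ∩ V }`,
taken in `[0,∞]` with `inf ∅ = ∞`. -/
noncomputable def lamSet {𝕜 E F : Type*} [RCLike 𝕜]
    [NormedAddCommGroup E] [InnerProductSpace 𝕜 E]
    [NormedAddCommGroup F] [InnerProductSpace 𝕜 F]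
    (T : E →ₗ.[𝕜] F) (V : Set E) : ℝ≥0∞ :=
  ⨅ x : {x : T.domain // (x : E) ≠ 0 ∧ (x : E) ∈ V},
    ENNReal.ofReal (‖T x.1‖ / ‖(x.1 : E)‖)

namespace Submodule

variable {𝕜 E F : Type*} [RCLike 𝕜]
  [NormedAddCommGroup E] [InnerProductSpace 𝕜 E]
  [NormedAddCommGroup F] [InnerProductSpace 𝕜 F]

theorem adjoint_adjoint_of_isClosed [CompleteSpace E] [CompleteSpace F]
    (g : Submodule 𝕜 (E × F)) (hg : _root_.IsClosed (g : Set (E × F))) :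
    g.adjoint.adjoint = g := by
  let e := WithLp.prodContinuousLinearEquiv 2 𝕜 E F
  let G : Submodule 𝕜 (WithLp 2 (E × F)) := g.comap (e : WithLp 2 (E × F) →ₗ[𝕜] E × F)
  have hG : _root_.IsClosed (G : Set (WithLp 2 (E × F))) := hg.preimage e.continuous
  have : CompleteSpace G := hG.completeSpace_coe
  ext ⟨a, b⟩
  constructor
  · intro h
    rw [mem_adjoint_iff] at h
    have key : WithLp.toLp 2 (a, b) ∈ Gᗮᗮ := by
      intro w hw
      have hw' : ((WithLp.snd w, -WithLp.fst w) : F × E) ∈ g.adjoint := by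
        rw [mem_adjoint_iff]
        intro c d hcd
        have := hw (WithLp.toLp 2 (c, d)) hcd
        simp only [WithLp.prod_inner_apply] at this
        simp only [inner_neg_right, sub_neg_eq_add]
        rw [add_comm]
        exact this
      have := h _ _ hw'
      simp only [inner_neg_left] at this
      simp only [WithLp.prod_inner_apply]
      have h2 := neg_eq_zero.mpr this
      rw [neg_sub, sub_neg_eq_add, add_comm] at h2
      exact h2
    rw [orthogonal_orthogonal] at key
    exact key
  · intro h
    rw [mem_adjoint_iff]
    intro c d hcd
    rw [mem_adjoint_iff] at hcd
    have := hcd a b h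
    have h2 := congrArg (starRingEnd 𝕜) this
    simp only [map_sub, inner_conj_symm, map_zero] at h2
    rw [← neg_sub, h2, neg_zero]

end Submodule

namespace LinearPMap

variable {𝕜 E F : Type*} [RCLike 𝕜]
  [NormedAddCommGroup E] [InnerProductSpace 𝕜 E]
  [NormedAddCommGroup F] [InnerProductSpace 𝕜 F]

theorem exists_apply_eq_iff_mem_graph {R E F : Type*} [Ring R] [AddCommGroup E] [Module R E]
    [AddCommGroup F] [Module R F] (T : E →ₗ.[R] F) {x : E} {y : F} :
    (∃ h : x ∈ T.domain, T ⟨x, h⟩ = y) ↔ (x, y) ∈ T.graph := by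
  simp [mem_graph_iff]

theorem exists_apply_apply_eq_iff_mem_graph {R E F G : Type*} [Ring R] [AddCommGroup E] [Module R E]
    [AddCommGroup F] [Module R F] [AddCommGroup G] [Module R G] (S : E →ₗ.[R] F) (T : F →ₗ.[R] G)
    {x : E} {z : G} :
    (∃ (h : x ∈ S.domain) (h' : S ⟨x, h⟩ ∈ T.domain), T ⟨S ⟨x, h⟩, h'⟩ = z) ↔
      ∃ y, (x, y) ∈ S.graph ∧ (y, z) ∈ T.graph := by
  constructor
  · rintro ⟨h, h', hz⟩
    exact ⟨_, S.mem_graph ⟨x, h⟩, T.exists_apply_eq_iff_mem_graph.mp ⟨h', hz⟩⟩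
  · rintro ⟨y, hxy, hyz⟩
    obtain ⟨h, rfl⟩ := S.exists_apply_eq_iff_mem_graph.mpr hxy
    exact ⟨h, T.exists_apply_eq_iff_mem_graph.mpr hyz⟩

theorem mem_graph_zero_of_mem_closure {T : E →ₗ.[𝕜] F} (hc : T.IsClosed) {s : Set E}
    (hs : ∀ x ∈ s, (x, (0 : F)) ∈ T.graph) {x : E} (hx : x ∈ _root_.closure s) :
    (x, (0 : F)) ∈ T.graph := by
  have : _root_.IsClosed {x : E | (x, (0 : F)) ∈ T.graph} :=
    _root_.IsClosed.preimage (f := fun x : E => (x, (0 : F))) (by fun_prop) hc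
  exact this.closure_subset_iff.mpr hs hx

variable [CompleteSpace E]

theorem inner_eq_of_mem_graph_adjoint {T : E →ₗ.[𝕜] F} (hd : Dense (T.domain : Set E))
    {a : E} {b : F} {u : F} {v : E} (h : (a, b) ∈ T.graph) (h' : (u, v) ∈ T.adjoint.graph) :
    inner 𝕜 b u = inner 𝕜 a v := by
  rw [adjoint_graph_eq_graph_adjoint hd, Submodule.mem_adjoint_iff] at h'
  exact sub_eq_zero.mp (h' a b h)

theorem mem_graph_adjoint {T : E →ₗ.[𝕜] F} (hd : Dense (T.domain : Set E)) {u : F} {v : E}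
    (h : ∀ z : T.domain, inner 𝕜 (T z) u = inner 𝕜 (z : E) v) : (u, v) ∈ T.adjoint.graph := by
  rw [adjoint_graph_eq_graph_adjoint hd, Submodule.mem_adjoint_iff]
  intro a b hab
  obtain ⟨ha, rfl⟩ := T.exists_apply_eq_iff_mem_graph.mpr hab
  exact sub_eq_zero.mpr (h ⟨a, ha⟩)

variable [CompleteSpace F]

theorem dense_adjoint_domain {T : E →ₗ.[𝕜] F} (hd : Dense (T.domain : Set E)) (hc : T.IsClosed) :
    Dense (T.adjoint.domain : Set F) := by
  rw [Submodule.dense_iff_topologicalClosure_eq_top,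
    Submodule.topologicalClosure_eq_top_iff, Submodule.eq_bot_iff]
  intro v hv
  have h : ((0 : E), v) ∈ T.graph := by
    rw [← T.graph.adjoint_adjoint_of_isClosed hc, ← adjoint_graph_eq_graph_adjoint hd,
      Submodule.mem_adjoint_iff]
    intro a b hab
    obtain ⟨ha, -⟩ := T.adjoint.exists_apply_eq_iff_mem_graph.mpr hab
    simp [hv a ha]
  exact T.graph_fst_eq_zero_snd h rfl

theorem adjoint_adjoint {T : E →ₗ.[𝕜] F} (hd : Dense (T.domain : Set E)) (hc : T.IsClosed) :
    T.adjoint.adjoint = T := by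
  apply eq_of_eq_graph
  rw [adjoint_graph_eq_graph_adjoint (dense_adjoint_domain hd hc),
    adjoint_graph_eq_graph_adjoint hd, T.graph.adjoint_adjoint_of_isClosed hc]

/-- Removing the kernel component of a vector `z` in the domain of a closed operator. -/
theorem exists_mem_closure_pRange_adjoint {T : E →ₗ.[𝕜] F} (hd : Dense (T.domain : Set E))
    (hc : T.IsClosed) {z : E} {w : F} (hz : (z, w) ∈ T.graph) :
    ∃ v ∈ _root_.closure (pRange T.adjoint), (v, w) ∈ T.graph ∧
      ∀ x ∈ _root_.closure (pRange T.adjoint), inner 𝕜 z x = inner 𝕜 v x := by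
  let K := (LinearMap.range T.adjoint.toFun).topologicalClosure
  have hKc : _root_.IsClosed (K : Set E) := Submodule.isClosed_topologicalClosure _
  have : CompleteSpace K := hKc.completeSpace_coe
  obtain ⟨v, hv, n, hn, rfl⟩ := K.exists_add_mem_mem_orthogonal z
  have hn0 : (n, (0 : F)) ∈ T.graph := by
    rw [← T.graph.adjoint_adjoint_of_isClosed hc, ← adjoint_graph_eq_graph_adjoint hd,
      Submodule.mem_adjoint_iff]
    intro a b hab
    obtain ⟨ha, rfl⟩ := T.adjoint.exists_apply_eq_iff_mem_graph.mpr hab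
    have : T.adjoint ⟨a, ha⟩ ∈ K := Submodule.le_topologicalClosure _ ⟨⟨a, ha⟩, rfl⟩
    simp [hn _ this]
  refine ⟨v, hv, by simpa using T.graph.sub_mem hz hn0, fun x hx => ?_⟩
  rw [inner_add_left, Submodule.inner_left_of_mem_orthogonal (K := K) hx hn, add_zero]

end LinearPMap

section PoincareFriedrichs

open scoped NNReal

variable {𝕜 E F : Type*} [RCLike 𝕜]
  [NormedAddCommGroup E] [InnerProductSpace 𝕜 E]
  [NormedAddCommGroup F] [InnerProductSpace 𝕜 F]

theorem coe_le_lamSet_iff (T : E →ₗ.[𝕜] F) (V : Set E) (c : ℝ≥0) :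
    (c : ℝ≥0∞) ≤ lamSet T V ↔
      ∀ x y, (x, y) ∈ T.graph → x ∈ V → (c : ℝ) * ‖x‖ ≤ ‖y‖ := by
  rw [lamSet, le_iInf_iff]
  constructor
  · intro h x y hxy hx
    obtain ⟨hd, rfl⟩ := T.exists_apply_eq_iff_mem_graph.mpr hxy
    by_cases hx0 : x = 0
    · simp [hx0]
    · have := h ⟨⟨x, hd⟩, hx0, hx⟩
      rw [← ENNReal.ofReal_coe_nnreal, ENNReal.ofReal_le_ofReal_iff (by positivity)] at this
      exact (le_div_iff₀ (norm_pos_iff.mpr hx0)).mp this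
  · rintro h ⟨x, hx0, hx⟩
    rw [← ENNReal.ofReal_coe_nnreal]
    exact ENNReal.ofReal_le_ofReal
      ((le_div_iff₀ (norm_pos_iff.mpr hx0)).mpr (h _ _ (T.mem_graph x) hx))

theorem lamSet_le_of_mem_graph {T : E →ₗ.[𝕜] F} {V : Set E} {x : E} {y : F}
    (hxy : (x, y) ∈ T.graph) (hx : x ∈ V) (hx0 : x ≠ 0) :
    lamSet T V ≤ ENNReal.ofReal (‖y‖ / ‖x‖) := by
  obtain ⟨hd, rfl⟩ := T.exists_apply_eq_iff_mem_graph.mpr hxy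
  exact iInf_le (fun x : {x : T.domain // (x : E) ≠ 0 ∧ (x : E) ∈ V} =>
    ENNReal.ofReal (‖T x.1‖ / ‖(x.1 : E)‖)) ⟨⟨x, hd⟩, hx0, hx⟩

theorem lamSet_adjoint_le [CompleteSpace E] [CompleteSpace F] {T : E →ₗ.[𝕜] F}
    (hd : Dense (T.domain : Set E)) (hc : T.IsClosed) :
    lamSet T.adjoint (closure (pRange T)) ≤ lamSet T (closure (pRange T.adjoint)) := by
  refine ENNReal.le_of_forall_nnreal_lt fun c hlt => ?_
  have hT := (coe_le_lamSet_iff _ _ _).mp hlt.le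
  refine (coe_le_lamSet_iff _ _ _).mpr fun z w hzw hz => ?_
  have key : ∀ p ∈ closure (pRange T.adjoint), (c : ℝ) * ‖inner 𝕜 z p‖ ≤ ‖w‖ * ‖p‖ := by
    have hclosed : IsClosed {p : E | (c : ℝ) * ‖inner 𝕜 z p‖ ≤ ‖w‖ * ‖p‖} :=
      isClosed_le (by fun_prop) (by fun_prop)
    refine hclosed.closure_subset_iff.mpr ?_
    rintro _ ⟨q, rfl⟩
    obtain ⟨q', hq', hgraph, -⟩ := LinearPMap.exists_mem_closure_pRange_adjoint
      (LinearPMap.dense_adjoint_domain hd hc) (LinearPMap.adjoint_isClosed hd)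
      (T.adjoint.mem_graph q)
    rw [LinearPMap.adjoint_adjoint hd hc] at hq'
    change (c : ℝ) * ‖inner 𝕜 z (T.adjoint q)‖ ≤ ‖w‖ * ‖T.adjoint q‖
    rw [← LinearPMap.inner_eq_of_mem_graph_adjoint hd hzw hgraph]
    calc (c : ℝ) * ‖inner 𝕜 w q'‖ ≤ c * (‖w‖ * ‖q'‖) := by
          gcongr; exact norm_inner_le_norm w q'
      _ = ‖w‖ * (c * ‖q'‖) := by ring
      _ ≤ _ := by gcongr; exact hT _ _ hgraph hq'
  rcases eq_or_ne z 0 with rfl | hz0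
  · simp
  · have := key z hz
    rw [inner_self_eq_norm_sq_to_K, ← RCLike.ofReal_pow, RCLike.norm_ofReal,
      abs_of_nonneg (by positivity), pow_two, ← mul_assoc] at this
    exact le_of_mul_le_mul_right this (norm_pos_iff.mpr hz0)

theorem lamSet_adjoint_eq [CompleteSpace E] [CompleteSpace F] {T : E →ₗ.[𝕜] F}
    (hd : Dense (T.domain : Set E)) (hc : T.IsClosed) :
    lamSet T.adjoint (closure (pRange T)) = lamSet T (closure (pRange T.adjoint)) := by
  refine le_antisymm (lamSet_adjoint_le hd hc) ?_
  have := lamSet_adjoint_le (LinearPMap.dense_adjoint_domain hd hc)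
    (LinearPMap.adjoint_isClosed hd)
  rwa [LinearPMap.adjoint_adjoint hd hc] at this

theorem exists_mem_graph_norm_eq [CompleteSpace F] {T : E →ₗ.[𝕜] F} (hc : T.IsClosed)
    {V : Submodule 𝕜 E} (hV : IsClosed (V : Set E)) {l : ℝ} (hl0 : 0 ≤ l)
    (hl : ∀ x y, (x, y) ∈ T.graph → x ∈ V → l * ‖x‖ ≤ ‖y‖)
    (happrox : ∀ ε > 0, ∃ x y, (x, y) ∈ T.graph ∧ x ∈ V ∧ ‖x‖ = 1 ∧ ‖y‖ < l + ε)
    (hcpt : ∀ (x : ℕ → E) (y : ℕ → F), (∀ n, (x n, y n) ∈ T.graph) → (∀ n, x n ∈ V) →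
      (∃ C : ℝ, ∀ n, ‖x n‖ + ‖y n‖ ≤ C) →
      ∃ φ : ℕ → ℕ, StrictMono φ ∧ ∃ a : E, Tendsto (fun k => x (φ k)) atTop (𝓝 a)) :
    ∃ x y, (x, y) ∈ T.graph ∧ x ∈ V ∧ ‖x‖ = 1 ∧ ‖y‖ = l := by
  choose x y hxy hxV hx1 hy using
    fun n : ℕ => happrox (1 / ((n : ℝ) + 1)) Nat.one_div_pos_of_nat
  have hly : ∀ n, l ≤ ‖y n‖ := fun n => by simpa [hx1 n] using hl _ _ (hxy n) (hxV n)
  have hylim : Tendsto (fun n => ‖y n‖) atTop (𝓝 l) := by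
    refine tendsto_of_tendsto_of_tendsto_of_le_of_le tendsto_const_nhds ?_ hly fun n => (hy n).le
    simpa using tendsto_const_nhds.add (tendsto_one_div_add_atTop_nhds_zero_nat (𝕜 := ℝ))
  obtain ⟨φ, hφ, a, ha⟩ := hcpt x y hxy hxV ⟨1 + (l + 1), fun n => by
    have : 1 / ((n : ℝ) + 1) ≤ 1 := by
      rw [div_le_one (by positivity)]
      simp
    linarith [hy n, hx1 n]⟩
  have hyφ : Tendsto (fun k => ‖y (φ k)‖) atTop (𝓝 l) := hylim.comp hφ.tendsto_atTop
  have hcauchy : CauchySeq fun k => y (φ k) := by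
    rw [cauchySeq_iff_tendsto_dist_atTop_0]
    have hdist := cauchySeq_iff_tendsto_dist_atTop_0.mp ha.cauchySeq
    have h1 : Tendsto (fun p : ℕ × ℕ => ‖y (φ p.1)‖) atTop (𝓝 l) := by
      rw [← prod_atTop_atTop_eq]; exact hyφ.comp tendsto_fst
    have h2 : Tendsto (fun p : ℕ × ℕ => ‖y (φ p.2)‖) atTop (𝓝 l) := by
      rw [← prod_atTop_atTop_eq]; exact hyφ.comp tendsto_snd
    have hbound : Tendsto (fun p : ℕ × ℕ => √(2 * (‖y (φ p.1)‖ ^ 2 + ‖y (φ p.2)‖ ^ 2) - 4 * l ^ 2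
        + l ^ 2 * dist (x (φ p.1)) (x (φ p.2)) ^ 2)) atTop (𝓝 0) := by
      have := ((((h1.pow 2).add (h2.pow 2)).const_mul 2).sub_const (4 * l ^ 2)).add
        ((hdist.pow 2).const_mul (l ^ 2))
      have := this.sqrt
      convert this using 2
      rw [eq_comm, Real.sqrt_eq_zero']
      nlinarith
    refine squeeze_zero (fun _ => dist_nonneg) (fun p => Real.le_sqrt_of_sq_le ?_) hbound
    have hpy := parallelogram_law_with_norm 𝕜 (y (φ p.1)) (y (φ p.2))
    have hpx := parallelogram_law_with_norm 𝕜 (x (φ p.1)) (x (φ p.2))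
    have hsum := hl _ _ (T.graph.add_mem (hxy (φ p.1)) (hxy (φ p.2)))
      (V.add_mem (hxV (φ p.1)) (hxV (φ p.2)))
    have hsq := pow_le_pow_left₀ (by positivity) hsum 2
    rw [hx1, hx1] at hpx
    rw [mul_pow] at hsq
    rw [dist_eq_norm, dist_eq_norm]
    linear_combination hsq + hpy - l ^ 2 * hpx
  obtain ⟨b, hb⟩ := cauchySeq_tendsto_of_complete hcauchy
  refine ⟨a, b, ?_, ?_, ?_, ?_⟩
  · exact hc.mem_of_tendsto (ha.prodMk_nhds hb) (Eventually.of_forall fun k => hxy (φ k))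
  · exact hV.mem_of_tendsto ha (Eventually.of_forall fun k => hxV (φ k))
  · exact tendsto_nhds_unique ha.norm (by simp [hx1])
  · exact tendsto_nhds_unique hb.norm hyφ

theorem inner_eq_of_norm_eq_mul_norm {T : E →ₗ.[𝕜] F} {V : Submodule 𝕜 E} {l : ℝ} (hl0 : 0 ≤ l)
    (hl : ∀ x y, (x, y) ∈ T.graph → x ∈ V → l * ‖x‖ ≤ ‖y‖)
    {x : E} {y : F} (hxy : (x, y) ∈ T.graph) (hx : x ∈ V) (heq : ‖y‖ = l * ‖x‖)
    {z : E} {w : F} (hzw : (z, w) ∈ T.graph) (hz : z ∈ V) :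
    inner 𝕜 y w = ((l ^ 2 : ℝ) : 𝕜) * inner 𝕜 x z := by
  set D : 𝕜 := inner 𝕜 y w - ((l ^ 2 : ℝ) : 𝕜) * inner 𝕜 x z with hD
  set K : ℝ := ‖w‖ ^ 2 - l ^ 2 * ‖z‖ ^ 2 with hK
  have hK0 : 0 ≤ K := by
    have := pow_le_pow_left₀ (by positivity) (hl z w hzw hz) 2
    rw [mul_pow] at this
    linarith
  have hquad : ∀ s : ℝ, 0 ≤ -(2 * s) * ‖D‖ ^ 2 + s ^ 2 * ‖D‖ ^ 2 * K := by
    intro s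
    set t : 𝕜 := -((s : 𝕜) * (starRingEnd 𝕜) D) with ht
    have h := pow_le_pow_left₀ (by positivity)
      (hl _ _ (T.graph.add_mem hxy (T.graph.smul_mem t hzw))
      (V.add_mem hx (V.smul_mem t hz))) 2
    change (l * ‖x + t • z‖) ^ 2 ≤ ‖y + t • w‖ ^ 2 at h
    rw [mul_pow, norm_add_sq (𝕜 := 𝕜) x, norm_add_sq (𝕜 := 𝕜) y, inner_smul_right, inner_smul_right,
      norm_smul, norm_smul, heq] at h
    have hre : RCLike.re (t * inner 𝕜 y w) - l ^ 2 * RCLike.re (t * inner 𝕜 x z)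
        = -(s * ‖D‖ ^ 2) := by
      rw [← RCLike.re_ofReal_mul, ← map_sub]
      have : t * inner 𝕜 y w - ((l ^ 2 : ℝ) : 𝕜) * (t * inner 𝕜 x z)
          = ((-(s * ‖D‖ ^ 2) : ℝ) : 𝕜) := by
        have hDD := RCLike.conj_mul D
        push_cast at hD ⊢
        rw [← hDD, ht, hD]
        ring
      rw [this, RCLike.ofReal_re]
    have htn : ‖t‖ ^ 2 = s ^ 2 * ‖D‖ ^ 2 := by
      rw [ht, norm_neg, norm_mul, RCLike.norm_conj, RCLike.norm_ofReal, mul_pow, sq_abs]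
    rw [mul_pow ‖t‖ ‖z‖, mul_pow ‖t‖ ‖w‖, htn] at h
    rw [hK]
    linear_combination h + 2 * hre
  have hD0 : ‖D‖ ^ 2 ≤ 0 := by
    have h := hquad (1 / (K + 1))
    have h1 : -(2 * (1 / (K + 1))) * ‖D‖ ^ 2 + (1 / (K + 1)) ^ 2 * ‖D‖ ^ 2 * K
      = -((K + 2) / (K + 1) ^ 2) * ‖D‖ ^ 2 := by
      field_simp
      ring
    rw [h1] at h
    have h2 : 0 < (K + 2) / (K + 1) ^ 2 := by positivity
    nlinarith
  have : D = 0 := by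
    rw [← norm_eq_zero]
    exact pow_eq_zero_iff two_ne_zero |>.mp (le_antisymm hD0 (by positivity))
  exact sub_eq_zero.mp this

/-- The infimum of the positive eigenvalues of `T* T` is the square of the Poincaré–Friedrichs
infimum of the reduced operator. -/
theorem sInf_eigenvalues_eq_lamSet_sq [CompleteSpace E] [CompleteSpace F] {T : E →ₗ.[𝕜] F}
    (hd : Dense (T.domain : Set E)) (hc : T.IsClosed)
    (hcpt : ∀ (x : ℕ → E) (y : ℕ → F), (∀ n, (x n, y n) ∈ T.graph) →
      (∀ n, x n ∈ closure (pRange T.adjoint)) → (∃ C : ℝ, ∀ n, ‖x n‖ + ‖y n‖ ≤ C) →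
      ∃ φ : ℕ → ℕ, StrictMono φ ∧ ∃ a : E, Tendsto (fun k => x (φ k)) atTop (𝓝 a)) :
    sInf {ν : ℝ≥0∞ | ∃ r : ℝ, 0 < r ∧ ν = ENNReal.ofReal r ∧ ∃ x : E, x ≠ 0 ∧
        ∃ y, (x, y) ∈ T.graph ∧ (y, (r : 𝕜) • x) ∈ T.adjoint.graph} =
      lamSet T (closure (pRange T.adjoint)) ^ 2 := by
  let V := (LinearMap.range T.adjoint.toFun).topologicalClosure
  have hV : IsClosed (V : Set E) := Submodule.isClosed_topologicalClosure _
  apply le_antisymm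
  · by_cases htop : lamSet T (closure (pRange T.adjoint)) = ⊤
    · simp [htop]
    lift lamSet T (closure (pRange T.adjoint)) to ℝ≥0 using htop with l hlam
    have hl := (coe_le_lamSet_iff T _ l).mp hlam.le
    have happrox : ∀ ε > 0, ∃ x y, (x, y) ∈ T.graph ∧ x ∈ V ∧ ‖x‖ = 1 ∧ ‖y‖ < (l : ℝ) + ε := by
      intro ε hε
      lift ε to ℝ≥0 using hε.le
      have hlt : ¬ ((l + ε : ℝ≥0) : ℝ≥0∞) ≤ lamSet T (closure (pRange T.adjoint)) := by
        rw [← hlam, ENNReal.coe_le_coe, not_le]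
        exact lt_add_of_pos_right l hε
      rw [coe_le_lamSet_iff] at hlt
      push Not at hlt
      obtain ⟨x, y, hxy, hx, hlt⟩ := hlt
      have hx0 : x ≠ 0 := by
        rintro rfl
        rw [norm_zero, mul_zero] at hlt
        exact (norm_nonneg y).not_gt hlt
      refine ⟨((‖x‖⁻¹ : ℝ) : 𝕜) • x, ((‖x‖⁻¹ : ℝ) : 𝕜) • y, T.graph.smul_mem _ hxy,
        V.smul_mem _ hx, ?_, ?_⟩
      · rw [norm_smul, RCLike.norm_ofReal, abs_of_nonneg (by positivity),
          inv_mul_cancel₀ (norm_ne_zero_iff.mpr hx0)]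
      · rw [norm_smul, RCLike.norm_ofReal, abs_of_nonneg (by positivity), inv_mul_eq_div,
          div_lt_iff₀ (norm_pos_iff.mpr hx0)]
        exact_mod_cast hlt
    obtain ⟨x, y, hxy, hxV, hx1, hy⟩ :=
      exists_mem_graph_norm_eq (V := V) hc hV l.coe_nonneg hl happrox hcpt
    have hx0 : x ≠ 0 := by
      rintro rfl
      simp at hx1
    have heig : (y, (((l : ℝ) ^ 2 : ℝ) : 𝕜) • x) ∈ T.adjoint.graph := by
      refine LinearPMap.mem_graph_adjoint hd fun z => ?_
      obtain ⟨v, hv, hvw, hvx⟩ :=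
        LinearPMap.exists_mem_closure_pRange_adjoint hd hc (T.mem_graph z)
      have := inner_eq_of_norm_eq_mul_norm (V := V) l.coe_nonneg hl hxy hxV
        (by rw [hy, hx1, mul_one]) hvw hv
      rw [inner_smul_right, hvx x hxV, ← inner_conj_symm, this, map_mul, RCLike.conj_ofReal,
        inner_conj_symm]
    have hl0 : l ≠ 0 := by
      rintro rfl
      have hy0 : y = 0 := by simpa using hy
      subst hy0
      have hker : ∀ p ∈ closure (pRange T.adjoint), inner 𝕜 x p = 0 := by
        have hclosed : IsClosed {p : E | inner 𝕜 x p = 0} :=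
          isClosed_eq (by fun_prop) continuous_const
        refine hclosed.closure_subset_iff.mpr ?_
        rintro _ ⟨q, rfl⟩
        have := LinearPMap.inner_eq_of_mem_graph_adjoint hd hxy (T.adjoint.mem_graph q)
        rw [inner_zero_left] at this
        exact this.symm
      exact hx0 (inner_self_eq_zero.mp (hker x hxV))
    refine sInf_le ⟨(l : ℝ) ^ 2, by positivity, ?_, x, hx0, y, hxy, heig⟩
    rw [ENNReal.ofReal_pow l.coe_nonneg, ENNReal.ofReal_coe_nnreal]
  · refine le_sInf ?_
    rintro _ ⟨r, hr, rfl, x, hx0, y, hxy, hyx⟩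
    have hxV : x ∈ V := by
      refine Submodule.le_topologicalClosure _ ?_
      have hr' : (r : 𝕜) ≠ 0 := by exact_mod_cast hr.ne'
      have hmem := T.adjoint.graph.smul_mem (r : 𝕜)⁻¹ hyx
      rw [Prod.smul_mk, inv_smul_smul₀ hr'] at hmem
      obtain ⟨h, hx⟩ := T.adjoint.exists_apply_eq_iff_mem_graph.mpr hmem
      exact ⟨⟨_, h⟩, hx⟩
    have hnorm : ‖y‖ ^ 2 = r * ‖x‖ ^ 2 := by
      have := LinearPMap.inner_eq_of_mem_graph_adjoint hd hxy hyx
      rw [inner_smul_right, inner_self_eq_norm_sq_to_K, inner_self_eq_norm_sq_to_K] at this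
      exact_mod_cast this
    calc lamSet T (closure (pRange T.adjoint)) ^ 2
        ≤ ENNReal.ofReal (‖y‖ / ‖x‖) ^ 2 := by
          gcongr
          exact lamSet_le_of_mem_graph hxy hxV hx0
      _ = ENNReal.ofReal r := by
          rw [← ENNReal.ofReal_pow (by positivity), div_pow, hnorm,
            mul_div_cancel_right₀ _ (pow_ne_zero 2 (norm_ne_zero_iff.mpr hx0))]

end PoincareFriedrichs

variable {𝕜 H₀ H₁ H₂ : Type*} [RCLike 𝕜]
  [NormedAddCommGroup H₀] [InnerProductSpace 𝕜 H₀] [CompleteSpace H₀]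
  [NormedAddCommGroup H₁] [InnerProductSpace 𝕜 H₁] [CompleteSpace H₁]
  [NormedAddCommGroup H₂] [InnerProductSpace 𝕜 H₂] [CompleteSpace H₂]

/-- For a Hilbert complex `A₀, A₁` with compact embedding
`D(A₁) ∩ D(A₀*) ↪ H₁`: a scalar `μ ≠ 0` is an eigenvalue of `A₀A₀* + A₁*A₁` iff it is an
eigenvalue of `A₀A₀*` or of `A₁*A₁`; in particular the smallest positive eigenvalue of
`A₀A₀* + A₁*A₁` equals `min {λ_{A₀}², λ_{A₁}²}`. -/
theorem hodge_laplacian_eigenvalues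
    (T₀ : H₀ →ₗ.[𝕜] H₁) (T₁ : H₁ →ₗ.[𝕜] H₂)
    (hd₀ : Dense (T₀.domain : Set H₀)) (hc₀ : T₀.IsClosed)
    (hd₁ : Dense (T₁.domain : Set H₁)) (hc₁ : T₁.IsClosed)
    (hcplx : ∀ x : T₀.domain, ∃ h : T₀ x ∈ T₁.domain, T₁ ⟨T₀ x, h⟩ = 0)
    (hcpt : CompactPair T₁ T₀.adjoint) :
    (∀ μ : 𝕜, μ ≠ 0 →
      ((∃ x : H₁, x ≠ 0 ∧ ∃ (h1 : x ∈ T₁.domain) (h0 : x ∈ T₀.adjoint.domain)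
          (h1' : T₁ ⟨x, h1⟩ ∈ T₁.adjoint.domain)
          (h0' : T₀.adjoint ⟨x, h0⟩ ∈ T₀.domain),
          T₀ ⟨T₀.adjoint ⟨x, h0⟩, h0'⟩ + T₁.adjoint ⟨T₁ ⟨x, h1⟩, h1'⟩ = μ • x) ↔
        ((∃ y : H₁, y ≠ 0 ∧ ∃ (h0 : y ∈ T₀.adjoint.domain)
            (h0' : T₀.adjoint ⟨y, h0⟩ ∈ T₀.domain),
            T₀ ⟨T₀.adjoint ⟨y, h0⟩, h0'⟩ = μ • y) ∨
          (∃ y : H₁, y ≠ 0 ∧ ∃ (h1 : y ∈ T₁.domain)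
            (h1' : T₁ ⟨y, h1⟩ ∈ T₁.adjoint.domain),
            T₁.adjoint ⟨T₁ ⟨y, h1⟩, h1'⟩ = μ • y)))) ∧
    sInf {ν : ℝ≥0∞ | ∃ r : ℝ, 0 < r ∧ ν = ENNReal.ofReal r ∧
        ∃ x : H₁, x ≠ 0 ∧ ∃ (h1 : x ∈ T₁.domain) (h0 : x ∈ T₀.adjoint.domain)
          (h1' : T₁ ⟨x, h1⟩ ∈ T₁.adjoint.domain)
          (h0' : T₀.adjoint ⟨x, h0⟩ ∈ T₀.domain),
          T₀ ⟨T₀.adjoint ⟨x, h0⟩, h0'⟩ + T₁.adjoint ⟨T₁ ⟨x, h1⟩, h1'⟩ = ((r : ℝ) : 𝕜) • x} =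
      min ((lamSet T₀ (closure (pRange T₀.adjoint))) ^ 2)
        ((lamSet T₁ (closure (pRange T₁.adjoint))) ^ 2) := by
  have hker₁ : ∀ {u p}, (u, p) ∈ T₀.graph → (p, (0 : H₂)) ∈ T₁.graph := by
    intro u p h
    obtain ⟨hu, rfl⟩ := T₀.exists_apply_eq_iff_mem_graph.mpr h
    exact T₁.exists_apply_eq_iff_mem_graph.mp (hcplx ⟨u, hu⟩)
  have hker₀ : ∀ {w q}, (w, q) ∈ T₁.adjoint.graph → (q, (0 : H₀)) ∈ T₀.adjoint.graph := by
    intro w q h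
    refine LinearPMap.mem_graph_adjoint hd₀ fun z => ?_
    rw [← LinearPMap.inner_eq_of_mem_graph_adjoint hd₁ (hker₁ (T₀.mem_graph z)) h,
      inner_zero_left, inner_zero_right]
  have hd₀' := LinearPMap.dense_adjoint_domain hd₀ hc₀
  have hc₀' := LinearPMap.adjoint_isClosed hd₀
  have hT₀ := LinearPMap.adjoint_adjoint hd₀ hc₀
  have hsum : ∀ (x : H₁) (μ : 𝕜), (∃ (h1 : x ∈ T₁.domain) (h0 : x ∈ T₀.adjoint.domain)
      (h1' : T₁ ⟨x, h1⟩ ∈ T₁.adjoint.domain) (h0' : T₀.adjoint ⟨x, h0⟩ ∈ T₀.domain),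
      T₀ ⟨T₀.adjoint ⟨x, h0⟩, h0'⟩ + T₁.adjoint ⟨T₁ ⟨x, h1⟩, h1'⟩ = μ • x) ↔
      ∃ u p w q, (x, u) ∈ T₀.adjoint.graph ∧ (u, p) ∈ T₀.graph ∧ (x, w) ∈ T₁.graph ∧
        (w, q) ∈ T₁.adjoint.graph ∧ p + q = μ • x := by
    intro x μ
    constructor
    · rintro ⟨h1, h0, h1', h0', h⟩
      exact ⟨_, _, _, _, T₀.adjoint.mem_graph ⟨x, h0⟩, T₀.mem_graph ⟨_, h0'⟩,
        T₁.mem_graph ⟨x, h1⟩, T₁.adjoint.mem_graph ⟨_, h1'⟩, h⟩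
    · rintro ⟨u, p, w, q, hxu, hup, hxw, hwq, h⟩
      obtain ⟨h0, rfl⟩ := T₀.adjoint.exists_apply_eq_iff_mem_graph.mpr hxu
      obtain ⟨h0', rfl⟩ := T₀.exists_apply_eq_iff_mem_graph.mpr hup
      obtain ⟨h1, rfl⟩ := T₁.exists_apply_eq_iff_mem_graph.mpr hxw
      obtain ⟨h1', rfl⟩ := T₁.adjoint.exists_apply_eq_iff_mem_graph.mpr hwq
      exact ⟨h1, h0, h1', h0', h⟩
  simp only [hsum, LinearPMap.exists_apply_apply_eq_iff_mem_graph]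
  have heigen : ∀ μ : 𝕜, μ ≠ 0 → ((∃ x : H₁, x ≠ 0 ∧ ∃ u p w q, (x, u) ∈ T₀.adjoint.graph ∧
      (u, p) ∈ T₀.graph ∧ (x, w) ∈ T₁.graph ∧ (w, q) ∈ T₁.adjoint.graph ∧ p + q = μ • x) ↔
      ((∃ y : H₁, y ≠ 0 ∧ ∃ u, (y, u) ∈ T₀.adjoint.graph ∧ (u, μ • y) ∈ T₀.graph) ∨
        (∃ y : H₁, y ≠ 0 ∧ ∃ w, (y, w) ∈ T₁.graph ∧ (w, μ • y) ∈ T₁.adjoint.graph))) := by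
    intro μ hμ
    constructor
    · rintro ⟨x, hx0, u, p, w, q, hxu, hup, hxw, hwq, h⟩
      by_cases hp : p = 0
      · rw [hp, zero_add] at h
        exact Or.inr ⟨x, hx0, w, hxw, h ▸ hwq⟩
      · refine Or.inl ⟨p, hp, μ • u, ?_, T₀.graph.smul_mem μ hup⟩
        have := T₀.adjoint.graph.sub_mem (T₀.adjoint.graph.smul_mem μ hxu) (hker₀ hwq)
        rwa [Prod.smul_mk, Prod.mk_sub_mk, sub_zero, ← h, add_sub_cancel_right] at this
    · rintro (⟨y, hy0, u, hyu, huy⟩ | ⟨y, hy0, w, hyw, hwy⟩)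
      · have := T₁.graph.smul_mem μ⁻¹ (hker₁ huy)
        rw [Prod.smul_mk, inv_smul_smul₀ hμ, smul_zero] at this
        exact ⟨y, hy0, u, _, 0, 0, hyu, huy, this, T₁.adjoint.graph.zero_mem, add_zero _⟩
      · have := T₀.adjoint.graph.smul_mem μ⁻¹ (hker₀ hwy)
        rw [Prod.smul_mk, inv_smul_smul₀ hμ, smul_zero] at this
        exact ⟨y, hy0, 0, 0, w, _, this, T₀.graph.zero_mem, hyw, hwy, zero_add _⟩
  refine ⟨heigen, ?_⟩
  have hcompact : ∀ (x : ℕ → H₁) (w : ℕ → H₂) (u : ℕ → H₀), (∀ n, (x n, w n) ∈ T₁.graph) →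
      (∀ n, (x n, u n) ∈ T₀.adjoint.graph) → (∃ C : ℝ, ∀ n, ‖x n‖ + ‖w n‖ + ‖u n‖ ≤ C) →
      ∃ φ : ℕ → ℕ, StrictMono φ ∧ ∃ l : H₁, Tendsto (fun k => x (φ k)) atTop (𝓝 l) := by
    intro x w u hw hu hC
    choose h1 hw using fun n => T₁.exists_apply_eq_iff_mem_graph.mpr (hw n)
    choose h0 hu using fun n => T₀.adjoint.exists_apply_eq_iff_mem_graph.mpr (hu n)
    refine hcpt x h1 h0 ?_
    simpa only [hw, hu] using hC
  have hinf₀ := sInf_eigenvalues_eq_lamSet_sq hd₀' hc₀' (by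
    rw [hT₀]
    intro x u hxu hx hC
    refine hcompact x 0 u (fun n => ?_) hxu (by simpa using hC)
    refine LinearPMap.mem_graph_zero_of_mem_closure hc₁ ?_ (hx n)
    rintro _ ⟨z, rfl⟩
    exact hker₁ (T₀.mem_graph z))
  have hinf₁ := sInf_eigenvalues_eq_lamSet_sq hd₁ hc₁ (by
    intro x w hxw hx hC
    refine hcompact x w 0 hxw (fun n => ?_) (by simpa using hC)
    refine LinearPMap.mem_graph_zero_of_mem_closure hc₀' ?_ (hx n)
    rintro _ ⟨z, rfl⟩
    exact hker₀ (T₁.adjoint.mem_graph z))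
  rw [hT₀, lamSet_adjoint_eq hd₀ hc₀] at hinf₀
  rw [← hinf₀, ← hinf₁, ← sInf_union]
  congr 1
  ext ν
  constructor
  · rintro ⟨r, hr, hν, h⟩
    rcases (heigen r (by exact_mod_cast hr.ne')).mp h with h | h
    · exact Or.inl ⟨r, hr, hν, h⟩
    · exact Or.inr ⟨r, hr, hν, h⟩
  · rintro (⟨r, hr, hν, h⟩ | ⟨r, hr, hν, h⟩)
    · exact ⟨r, hr, hν, (heigen r (by exact_mod_cast hr.ne')).mpr (Or.inl h)⟩
    · exact ⟨r, hr, hν, (heigen r (by exact_mod_cast hr.ne')).mpr (Or.inr h)⟩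
end
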